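/- Let s be a natural number with s ≢ 2 (mod 3), let m = 12s + 11 and δ = (24s+23)(48s+45), and suppose that l = 8m + 3 is prime. If n and n + δ are both perfect numbers, and p is a prime with 2^p - 1 prime and n + δ = 2^(p-1)·(2^p - 1), then 2^(p-1) - 2m - 1 is a perfect square, and there exist a prime q with q ≡ 5 (mod 8) and a natural number v not divisible by q such that 2^p + 4m + 1 = q^(4β+1)·v^2 for some natural number β. -/

import Mathlib

/-- An odd number with odd divisor sum is a perfect square. -/
theorem sq_of_odd_sigma (k : ℕ) (hk : k % 2 = 1) (h : (∑ d ∈ k.divisors, d) % 2 = 1) :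
    ∃ u, k = u * u := by
  by_contra hc
  push Not at hc
  have hodd : ∀ d, d ∣ k → ((d : ℕ) : ZMod 2) = 1 := by
    intro d hd
    have h1 : Odd d := Odd.of_dvd_nat (Nat.odd_iff.2 hk) hd
    exact ZMod.natCast_eq_one_iff_odd.2 h1
  have key : ∑ d ∈ k.divisors, ((d : ℕ) : ZMod 2) = 0 := by
    refine Finset.sum_involution (fun d _ => k / d) ?_ ?_ ?_ ?_
    · intro d hd
      have hd' := Nat.dvd_of_mem_divisors hd
      rw [hodd d hd', hodd _ (Nat.div_dvd_of_dvd hd')]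
      decide
    · intro d hd _ he
      have hd' := Nat.dvd_of_mem_divisors hd
      have h2 := Nat.div_mul_cancel hd'
      rw [he] at h2
      exact hc d h2.symm
    · intro d hd
      have hd' := Nat.dvd_of_mem_divisors hd
      exact Nat.mem_divisors.2 ⟨Nat.div_dvd_of_dvd hd', by omega⟩
    · intro d hd
      have hd' := Nat.dvd_of_mem_divisors hd
      exact Nat.div_div_self hd' (by omega)
  have h3 : ((∑ d ∈ k.divisors, d : ℕ) : ZMod 2) = 0 := by push_cast; exact key
  rw [ZMod.natCast_eq_zero_iff] at h3
  omega

theorem even_sigma (k : ℕ) (hk : k % 2 = 1) (h3 : k % 3 = 2) :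
    2 ∣ ∑ d ∈ k.divisors, d := by
  by_contra hc
  obtain ⟨u, hu⟩ := sq_of_odd_sigma k hk (by omega)
  rw [hu, Nat.mul_mod] at h3
  have : u % 3 < 3 := Nat.mod_lt _ (by norm_num)
  interval_cases u % 3 <;> omega

theorem no_perfect (l A B : ℕ) (hl : l.Prime) (hl3 : l % 3 = 1) (hB : B = 2 * A + l)
    (hA0 : A % 2 = 1) (hA3 : A % 3 = 2) (hn : Nat.Perfect (A * B)) (hl2 : l % 2 = 1) : False := by
  have hpos : 0 < A * B := hn.2
  have hs := (Nat.perfect_iff_sum_divisors_eq_two_mul hpos).1 hn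
  obtain ⟨i, A', hA', rfl⟩ := Nat.exists_eq_pow_mul_and_not_dvd (n := A) (by omega) l hl.ne_one
  obtain ⟨j, B', hB', hBe⟩ := Nat.exists_eq_pow_mul_and_not_dvd (n := B) (by omega) l hl.ne_one
  have hpow : ∀ e, l ^ e % 3 = 1 := fun e => by rw [Nat.pow_mod, hl3]; simp
  have hpow2 : ∀ e, l ^ e % 2 = 1 := fun e => by rw [Nat.pow_mod, hl2]; simp
  have hB0 : B % 2 = 1 := by omega
  have hB3 : B % 3 = 2 := by omega
  have hcop : Nat.Coprime A' B' := by
    have hd : Nat.gcd A' B' ∣ l := by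
      have h1 : Nat.gcd A' B' ∣ B := by
        rw [hBe]; exact (Nat.gcd_dvd_right _ _).mul_left _
      have h2 : Nat.gcd A' B' ∣ 2 * (l ^ i * A') :=
        ((Nat.gcd_dvd_left A' B').mul_left _).mul_left _
      rw [hB] at h1
      exact (Nat.dvd_add_right h2).1 h1
    rcases (Nat.dvd_prime hl).1 hd with h | h
    · exact h
    · exact absurd (h ▸ Nat.gcd_dvd_left A' B') hA'
  have hcA : Nat.Coprime l A' := (Nat.Prime.coprime_iff_not_dvd hl).2 hA'
  have hcB : Nat.Coprime l B' := (Nat.Prime.coprime_iff_not_dvd hl).2 hB'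
  have eA : 2 ∣ ∑ d ∈ A'.divisors, d := by
    apply even_sigma
    · rw [Nat.mul_mod, hpow2] at hA0; omega
    · rw [Nat.mul_mod, hpow] at hA3; omega
  have eB : 2 ∣ ∑ d ∈ B'.divisors, d := by
    apply even_sigma
    · rw [hBe, Nat.mul_mod, hpow2] at hB0; omega
    · rw [hBe, Nat.mul_mod, hpow] at hB3; omega
  have hprod : (l ^ i * A') * B = l ^ (i + j) * (A' * B') := by rw [hBe]; ring
  have h4 : 4 ∣ ∑ d ∈ ((l ^ i * A') * B).divisors, d := by
    rw [hprod, Nat.Coprime.sum_divisors_mul ((hcA.mul_right hcB).pow_left _),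
      hcop.sum_divisors_mul]
    exact (mul_dvd_mul eA eB).mul_left _
  rw [hs] at h4
  have : (l ^ i * A' * B) % 2 = 1 := by rw [Nat.mul_mod, hA0, hB0]
  omega

theorem stmt_15 (s m n p : ℕ) (hs : s % 3 ≠ 2) (hm : m = 12 * s + 11)
    (hl : Nat.Prime (8 * m + 3))
    (hn : Nat.Perfect n) (hnδ : Nat.Perfect (n + (24 * s + 23) * (48 * s + 45)))
    (hp : Nat.Prime p) (hQ : Nat.Prime (2 ^ p - 1))
    (hform : n + (24 * s + 23) * (48 * s + 45) = 2 ^ (p - 1) * (2 ^ p - 1)) :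
    (∃ u : ℕ, (2 : ℤ) ^ (p - 1) - 2 * m - 1 = u ^ 2) ∧
    ∃ q v β : ℕ, Nat.Prime q ∧ q % 8 = 5 ∧ ¬ q ∣ v ∧
      2 ^ p + 4 * m + 1 = q ^ (4 * β + 1) * v ^ 2 := by
  -- The hypotheses are contradictory: both factors of `n` are 2 mod 3.
  exfalso
  rcases hp.eq_two_or_odd with rfl | hodd
  · norm_num at hform
    nlinarith
  obtain ⟨k, rfl⟩ : ∃ k, p = 2 * k + 1 := ⟨p / 2, by omega⟩
  have hk : k ≠ 0 := by
    rintro rfl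
    exact hp.ne_one rfl
  obtain ⟨x, hx⟩ : ∃ x, x = 2 ^ (2 * k) := ⟨_, rfl⟩
  have hx3 : x % 3 = 1 := by rw [hx, pow_mul, Nat.pow_mod]; simp
  have hx2 : x % 2 = 0 := by
    rw [hx]; exact Nat.mod_eq_zero_of_dvd (dvd_pow_self 2 (by omega))
  have hx' : 2 ^ (2 * k + 1) = 2 * x := by rw [hx]; ring
  rw [hx', Nat.add_sub_cancel, ← hx] at hform
  have hnpos := hn.2
  have hlt : 24 * s + 23 < x := by
    by_contra hc
    have h1 : x * (2 * x - 1) ≤ (24 * s + 23) * (48 * s + 45) :=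
      Nat.mul_le_mul (by omega) (by omega)
    omega
  obtain ⟨A, rfl⟩ : ∃ A, x = A + (24 * s + 23) := ⟨x - (24 * s + 23), by omega⟩
  have h5 : 2 * (A + (24 * s + 23)) - 1 = 2 * A + 48 * s + 45 := by omega
  rw [h5] at hform
  have hnAB : n = A * (2 * A + (8 * m + 3)) := by
    subst hm
    nlinarith
  rw [hnAB] at hn
  exact no_perfect (8 * m + 3) A _ hl (by omega) rfl (by omega) (by omega) hn (by omega)
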